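/- arXiv:1305.6115 — 4 statements merged into one kernel-verified Lean document; each statement's English description precedes it below -/
import Mathlib

section
/- Global satisfaction condition for hybridised propositional logic: for any HPL signature morphism φ : (P,Nom,Λ) → (P',Nom',Λ'), any (P',Nom',Λ')-model (M',W'), and any HPL sentence ρ over (P,Nom,Λ), the reduct of (M',W') along φ globally satisfies ρ (i.e. at every world) if and only if (M',W') globally satisfies the translated sentence Sen(φ)(ρ). -/
/-- Propositional logic formulas over a set `P` of propositional variables. -/
inductive PLForm (P : Type) : Type where
  | var : P → PLForm P
  | or : PLForm P → PLForm P → PLForm P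
  | and : PLForm P → PLForm P → PLForm P
  | imp : PLForm P → PLForm P → PLForm P
  | neg : PLForm P → PLForm P

/-- Satisfaction of a PL formula by a valuation `M : P → Bool`. -/
def PLSat {P : Type} (M : P → Bool) : PLForm P → Prop
  | .var p => M p = true
  | .or a b => PLSat M a ∨ PLSat M b
  | .and a b => PLSat M a ∧ PLSat M b
  | .imp a b => PLSat M a → PLSat M b
  | .neg a => ¬ PLSat M a

/-- PL sentence translation along a function `φ : P → P'`. -/
def PLTrans {P P' : Type} (φ : P → P') : PLForm P → PLForm P'
  | .var p => .var (φ p)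
  | .or a b => .or (PLTrans φ a) (PLTrans φ b)
  | .and a b => .and (PLTrans φ a) (PLTrans φ b)
  | .imp a b => .imp (PLTrans φ a) (PLTrans φ b)
  | .neg a => .neg (PLTrans φ a)

/-- Sentences of hybrid propositional logic over the signature `(P, Nom, Λ)`,
where `Λ n` is the set of modalities of arity `n + 1` (i.e. taking `n`
sentence arguments). -/
inductive HPLSent (P Nom : Type) (Λ : ℕ → Type) : Type where
  | base : PLForm P → HPLSent P Nom Λ
  | nom : Nom → HPLSent P Nom Λ
  | neg : HPLSent P Nom Λ → HPLSent P Nom Λ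
  | or : HPLSent P Nom Λ → HPLSent P Nom Λ → HPLSent P Nom Λ
  | and : HPLSent P Nom Λ → HPLSent P Nom Λ → HPLSent P Nom Λ
  | imp : HPLSent P Nom Λ → HPLSent P Nom Λ → HPLSent P Nom Λ
  | at : Nom → HPLSent P Nom Λ → HPLSent P Nom Λ
  | dia : {n : ℕ} → Λ n → (Fin n → HPLSent P Nom Λ) → HPLSent P Nom Λ
  | box : {n : ℕ} → Λ n → (Fin n → HPLSent P Nom Λ) → HPLSent P Nom Λ

/-- A model of hybrid propositional logic over `(P, Nom, Λ)`: a Kripke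
structure whose worlds carry propositional valuations. -/
structure HPLModel (P Nom : Type) (Λ : ℕ → Type) : Type 1 where
  W : Type
  nomI : Nom → W
  rel : ∀ {n : ℕ}, Λ n → W → (Fin n → W) → Prop
  val : W → P → Bool

/-- Local satisfaction of an HPL sentence at a world. -/
def HPLSat {P Nom : Type} {Λ : ℕ → Type} (M : HPLModel P Nom Λ) :
    M.W → HPLSent P Nom Λ → Prop
  | w, .base ρ => PLSat (M.val w) ρ
  | w, .nom i => M.nomI i = w
  | w, .neg ρ => ¬ HPLSat M w ρ
  | w, .or ρ ρ' => HPLSat M w ρ ∨ HPLSat M w ρ'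
  | w, .and ρ ρ' => HPLSat M w ρ ∧ HPLSat M w ρ'
  | w, .imp ρ ρ' => HPLSat M w ρ → HPLSat M w ρ'
  | _, .at i ρ => HPLSat M (M.nomI i) ρ
  | w, .dia l ξ => ∃ ws : Fin _ → M.W, M.rel l w ws ∧ ∀ k, HPLSat M (ws k) (ξ k)
  | w, .box l ξ => ∀ ws : Fin _ → M.W, M.rel l w ws → ∃ k, HPLSat M (ws k) (ξ k)

/-- Global satisfaction: satisfaction at every world. -/
def HPLGSat {P Nom : Type} {Λ : ℕ → Type} (M : HPLModel P Nom Λ)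
    (ρ : HPLSent P Nom Λ) : Prop :=
  ∀ w : M.W, HPLSat M w ρ

/-- A signature morphism of hybrid propositional logic. -/
structure HPLMor (P Nom : Type) (Λ : ℕ → Type) (P' Nom' : Type)
    (Λ' : ℕ → Type) : Type where
  sig : P → P'
  nom : Nom → Nom'
  ms : ∀ {n : ℕ}, Λ n → Λ' n

/-- Sentence translation along an HPL signature morphism. -/
def HPLTrans {P Nom : Type} {Λ : ℕ → Type} {P' Nom' : Type} {Λ' : ℕ → Type}
    (φ : HPLMor P Nom Λ P' Nom' Λ') : HPLSent P Nom Λ → HPLSent P' Nom' Λ'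
  | .base ρ => .base (PLTrans φ.sig ρ)
  | .nom i => .nom (φ.nom i)
  | .neg ρ => .neg (HPLTrans φ ρ)
  | .or ρ ρ' => .or (HPLTrans φ ρ) (HPLTrans φ ρ')
  | .and ρ ρ' => .and (HPLTrans φ ρ) (HPLTrans φ ρ')
  | .imp ρ ρ' => .imp (HPLTrans φ ρ) (HPLTrans φ ρ')
  | .at i ρ => .at (φ.nom i) (HPLTrans φ ρ)
  | .dia l ξ => .dia (φ.ms l) (fun k => HPLTrans φ (ξ k))
  | .box l ξ => .box (φ.ms l) (fun k => HPLTrans φ (ξ k))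

/-- Model reduct along an HPL signature morphism. -/
def HPLReduct {P Nom : Type} {Λ : ℕ → Type} {P' Nom' : Type} {Λ' : ℕ → Type}
    (φ : HPLMor P Nom Λ P' Nom' Λ') (M' : HPLModel P' Nom' Λ') :
    HPLModel P Nom Λ where
  W := M'.W
  nomI i := M'.nomI (φ.nom i)
  rel l := M'.rel (φ.ms l)
  val w p := M'.val w (φ.sig p)

/-- The satisfaction condition of propositional logic. -/
theorem PLSat_PLTrans {P P' : Type} (f : P → P') (M : P' → Bool) (ρ : PLForm P) :
    PLSat M (PLTrans f ρ) ↔ PLSat (fun p => M (f p)) ρ := by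
  induction ρ <;> simp_all only [PLSat, PLTrans]

/-- The local satisfaction condition of hybridised propositional logic. -/
theorem HPLSat_HPLReduct {P Nom : Type} {Λ : ℕ → Type}
    {P' Nom' : Type} {Λ' : ℕ → Type} (φ : HPLMor P Nom Λ P' Nom' Λ')
    (M' : HPLModel P' Nom' Λ') (w : M'.W) (ρ : HPLSent P Nom Λ) :
    HPLSat (HPLReduct φ M') w ρ ↔ HPLSat M' w (HPLTrans φ ρ) := by
  match ρ with
  | .base ρ =>
    simp only [HPLSat, HPLTrans]
    exact (PLSat_PLTrans φ.sig (M'.val w) ρ).symm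
  | .nom i => simp only [HPLSat, HPLTrans, HPLReduct]
  | .neg ρ =>
    simp only [HPLSat, HPLTrans]
    exact not_congr (HPLSat_HPLReduct φ M' w ρ)
  | .or ρ ρ' =>
    simp only [HPLSat, HPLTrans]
    exact or_congr (HPLSat_HPLReduct φ M' w ρ) (HPLSat_HPLReduct φ M' w ρ')
  | .and ρ ρ' =>
    simp only [HPLSat, HPLTrans]
    exact and_congr (HPLSat_HPLReduct φ M' w ρ) (HPLSat_HPLReduct φ M' w ρ')
  | .imp ρ ρ' =>
    simp only [HPLSat, HPLTrans]
    exact imp_congr (HPLSat_HPLReduct φ M' w ρ) (HPLSat_HPLReduct φ M' w ρ')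
  | .at i ρ =>
    simp only [HPLSat, HPLTrans]
    exact HPLSat_HPLReduct φ M' (M'.nomI (φ.nom i)) ρ
  | .dia l ξ =>
    simp only [HPLSat, HPLTrans]
    exact exists_congr fun ws => and_congr_right' <|
      forall_congr' fun k => HPLSat_HPLReduct φ M' (ws k) (ξ k)
  | .box l ξ =>
    simp only [HPLSat, HPLTrans]
    exact forall_congr' fun ws => imp_congr_right fun _ =>
      exists_congr fun k => HPLSat_HPLReduct φ M' (ws k) (ξ k)

/-- Global satisfaction condition for hybridised propositional
logic. -/
theorem HPL_global_satisfaction_condition {P Nom : Type} {Λ : ℕ → Type}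
    {P' Nom' : Type} {Λ' : ℕ → Type} (φ : HPLMor P Nom Λ P' Nom' Λ')
    (M' : HPLModel P' Nom' Λ') (ρ : HPLSent P Nom Λ) :
    HPLGSat (HPLReduct φ M') ρ ↔ HPLGSat M' (HPLTrans φ ρ) :=
  forall_congr' fun w => HPLSat_HPLReduct φ M' w ρ
end

section
/- Bisimulation invariance for hybridised propositional logic (instance of the paper's Theorem 2): let φ : (P,Nom,Λ) → (P',Nom',Λ') be an HPL signature morphism, (M,W) a (P,Nom,Λ)-model, (M',W') a (P',Nom',Λ')-model, and B a φ-bisimulation between them. Then for every pair of worlds with w B w' and every HPL sentence ρ over (P,Nom,Λ), (M,W) ⊨^w ρ if and only if (M',W') ⊨^{w'} Sen(φ)(ρ). -/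
/-- A `φ`-bisimulation between HPL models `(M,W)` and `(M',W')`: a non-empty
relation `B` satisfying conditions (i)–(v) of the paper's
Definition of bisimulation (instantiated to HPL, where elementary equivalence
of local PL models amounts to agreement of valuations up to translation). -/
structure IsHPLBisim {P Nom : Type} {Λ : ℕ → Type} {P' Nom' : Type}
    {Λ' : ℕ → Type} (φ : HPLMor P Nom Λ P' Nom' Λ')
    (M : HPLModel P Nom Λ) (M' : HPLModel P' Nom' Λ')
    (B : M.W → M'.W → Prop) : Prop where
  nonempty : ∃ w w', B w w'
  nom_iff : ∀ w w', B w w' → ∀ i : Nom, (M.nomI i = w ↔ M'.nomI (φ.nom i) = w')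
  elem_equiv : ∀ w w', B w w' → ∀ p : P, M.val w p = M'.val w' (φ.sig p)
  nom_rel : ∀ i : Nom, B (M.nomI i) (M'.nomI (φ.nom i))
  forth : ∀ {n : ℕ} (l : Λ n) (w : M.W) (w' : M'.W) (ws : Fin n → M.W),
    B w w' → M.rel l w ws →
    ∃ ws' : Fin n → M'.W, (∀ k, B (ws k) (ws' k)) ∧ M'.rel (φ.ms l) w' ws'
  back : ∀ {n : ℕ} (l : Λ n) (w : M.W) (w' : M'.W) (ws' : Fin n → M'.W),
    B w w' → M'.rel (φ.ms l) w' ws' →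
    ∃ ws : Fin n → M.W, (∀ k, B (ws k) (ws' k)) ∧ M.rel l w ws

/-- Satisfaction of PL formulas is invariant under translation, for valuations that agree up to
renaming of variables. -/
theorem PLSat_PLTrans_iff {P P' : Type} {φ : P → P'} {M : P → Bool} {M' : P' → Bool}
    (h : ∀ p, M p = M' (φ p)) (ρ : PLForm P) : PLSat M ρ ↔ PLSat M' (PLTrans φ ρ) := by
  induction ρ with
  | var p => simp only [PLSat, PLTrans, h]
  | or a b iha ihb => exact or_congr iha ihb
  | and a b iha ihb => exact and_congr iha ihb
  | imp a b iha ihb => exact imp_congr iha ihb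
  | neg a iha => exact not_congr iha

/-- Bisimulation invariance for hybridised propositional logic
(instance of the paper's Theorem 2). -/
theorem HPL_bisimulation_invariance {P Nom : Type} {Λ : ℕ → Type}
    {P' Nom' : Type} {Λ' : ℕ → Type} (φ : HPLMor P Nom Λ P' Nom' Λ')
    (M : HPLModel P Nom Λ) (M' : HPLModel P' Nom' Λ')
    (B : M.W → M'.W → Prop) (hB : IsHPLBisim φ M M' B) :
    ∀ (w : M.W) (w' : M'.W), B w w' → ∀ ρ : HPLSent P Nom Λ,
      (HPLSat M w ρ ↔ HPLSat M' w' (HPLTrans φ ρ)) := by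
  intro w w' hw ρ
  induction ρ generalizing w w' with
  | base ρ =>
    simp only [HPLSat, HPLTrans]
    exact PLSat_PLTrans_iff (hB.elem_equiv w w' hw) ρ
  | nom i => simpa only [HPLSat, HPLTrans] using hB.nom_iff w w' hw i
  | neg ρ ih => simp only [HPLSat, HPLTrans, ih w w' hw]
  | or ρ σ ihρ ihσ => simp only [HPLSat, HPLTrans, ihρ w w' hw, ihσ w w' hw]
  | and ρ σ ihρ ihσ => simp only [HPLSat, HPLTrans, ihρ w w' hw, ihσ w w' hw]
  | imp ρ σ ihρ ihσ => simp only [HPLSat, HPLTrans, ihρ w w' hw, ihσ w w' hw]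
  | dia l ξ ih =>
    simp only [HPLSat, HPLTrans]
    constructor
    · rintro ⟨ws, hr, hs⟩
      obtain ⟨ws', hb, hr'⟩ := hB.forth l w w' ws hw hr
      exact ⟨ws', hr', fun k => (ih k _ _ (hb k)).1 (hs k)⟩
    · rintro ⟨ws', hr', hs⟩
      obtain ⟨ws, hb, hr⟩ := hB.back l w w' ws' hw hr'
      exact ⟨ws, hr, fun k => (ih k _ _ (hb k)).2 (hs k)⟩
  | box l ξ ih =>
    simp only [HPLSat, HPLTrans]
    constructor
    · intro h ws' hr'
      obtain ⟨ws, hb, hr⟩ := hB.back l w w' ws' hw hr'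
      obtain ⟨k, hk⟩ := h ws hr
      exact ⟨k, (ih k _ _ (hb k)).1 hk⟩
    · intro h ws hr
      obtain ⟨ws', hb, hr'⟩ := hB.forth l w w' ws hw hr
      obtain ⟨k, hk⟩ := h ws' hr'
      exact ⟨k, (ih k _ _ (hb k)).2 hk⟩
  | _ i ρ ih => simpa only [HPLSat, HPLTrans] using ih _ _ (hB.nom_rel i)
end

section
/- Refinement preserves positive existential sentences in hybridised propositional logic (instance of the paper's Theorem 3): let φ : (P,Nom,Λ) → (P',Nom',Λ') be an HPL signature morphism and R a φ-refinement relation between models (M,W) and (M',W'). Then for every pair of worlds with w R w' and every positive existential HPL sentence ρ over (P,Nom,Λ), if (M,W) ⊨^w ρ then (M',W') ⊨^{w'} Sen(φ)(ρ). -/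
/-- Negation-free propositional formulas over `P`: built from variables using
only `∨` and `∧`. -/
inductive PLPosForm (P : Type) : Type where
  | var : P → PLPosForm P
  | or : PLPosForm P → PLPosForm P → PLPosForm P
  | and : PLPosForm P → PLPosForm P → PLPosForm P

/-- Satisfaction of a negation-free PL formula by a valuation. -/
def PLPosSat {P : Type} (M : P → Bool) : PLPosForm P → Prop
  | .var p => M p = true
  | .or a b => PLPosSat M a ∨ PLPosSat M b
  | .and a b => PLPosSat M a ∧ PLPosSat M b

/-- Translation of negation-free PL formulas along `φ : P → P'`. -/
def PLPosTrans {P P' : Type} (φ : P → P') : PLPosForm P → PLPosForm P'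
  | .var p => .var (φ p)
  | .or a b => .or (PLPosTrans φ a) (PLPosTrans φ b)
  | .and a b => .and (PLPosTrans φ a) (PLPosTrans φ b)

/-- Positive existential sentences of hybrid propositional logic over the
signature `(P, Nom, Λ)` (`Λ n` being the modalities taking `n` sentence
arguments): no negations, no implications and no box modalities occur. -/
inductive HPLPosSent (P Nom : Type) (Λ : ℕ → Type) : Type where
  | base : PLPosForm P → HPLPosSent P Nom Λ
  | nom : Nom → HPLPosSent P Nom Λ
  | or : HPLPosSent P Nom Λ → HPLPosSent P Nom Λ → HPLPosSent P Nom Λ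
  | and : HPLPosSent P Nom Λ → HPLPosSent P Nom Λ → HPLPosSent P Nom Λ
  | at : Nom → HPLPosSent P Nom Λ → HPLPosSent P Nom Λ
  | dia : {n : ℕ} → Λ n → (Fin n → HPLPosSent P Nom Λ) → HPLPosSent P Nom Λ

/-- Local satisfaction of a positive existential HPL sentence at a world. -/
def HPLPosSat {P Nom : Type} {Λ : ℕ → Type} (M : HPLModel P Nom Λ) :
    M.W → HPLPosSent P Nom Λ → Prop
  | w, .base ρ => PLPosSat (M.val w) ρ
  | w, .nom i => M.nomI i = w
  | w, .or ρ ρ' => HPLPosSat M w ρ ∨ HPLPosSat M w ρ'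
  | w, .and ρ ρ' => HPLPosSat M w ρ ∧ HPLPosSat M w ρ'
  | _, .at i ρ => HPLPosSat M (M.nomI i) ρ
  | w, .dia l ξ => ∃ ws : Fin _ → M.W, M.rel l w ws ∧ ∀ k, HPLPosSat M (ws k) (ξ k)

/-- Global satisfaction: satisfaction at every world. -/
def HPLPosGSat {P Nom : Type} {Λ : ℕ → Type} (M : HPLModel P Nom Λ)
    (ρ : HPLPosSent P Nom Λ) : Prop :=
  ∀ w : M.W, HPLPosSat M w ρ

/-- Translation of positive existential HPL sentences along a signature
morphism. -/
def HPLPosTrans {P Nom : Type} {Λ : ℕ → Type} {P' Nom' : Type} {Λ' : ℕ → Type}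
    (φ : HPLMor P Nom Λ P' Nom' Λ') : HPLPosSent P Nom Λ → HPLPosSent P' Nom' Λ'
  | .base ρ => .base (PLPosTrans φ.sig ρ)
  | .nom i => .nom (φ.nom i)
  | .or ρ ρ' => .or (HPLPosTrans φ ρ) (HPLPosTrans φ ρ')
  | .and ρ ρ' => .and (HPLPosTrans φ ρ) (HPLPosTrans φ ρ')
  | .at i ρ => .at (φ.nom i) (HPLPosTrans φ ρ)
  | .dia l ξ => .dia (φ.ms l) (fun k => HPLPosTrans φ (ξ k))

/-- A `φ`-refinement relation between HPL models: a non-empty relation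
satisfying conditions (f.i)–(f.iv) of the paper's definition of refinement,
instantiated to HPL. -/
structure IsHPLRefinement {P Nom : Type} {Λ : ℕ → Type} {P' Nom' : Type}
    {Λ' : ℕ → Type} (φ : HPLMor P Nom Λ P' Nom' Λ')
    (M : HPLModel P Nom Λ) (M' : HPLModel P' Nom' Λ')
    (R : M.W → M'.W → Prop) : Prop where
  nonempty : ∃ w w', R w w'
  nom_imp : ∀ w w', R w w' → ∀ i : Nom, M.nomI i = w → M'.nomI (φ.nom i) = w'
  elem_pres : ∀ w w', R w w' → ∀ ρ : PLPosForm P,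
    PLPosSat (M.val w) ρ → PLPosSat (M'.val w') (PLPosTrans φ.sig ρ)
  nom_rel : ∀ i : Nom, R (M.nomI i) (M'.nomI (φ.nom i))
  forth : ∀ {n : ℕ} (l : Λ n) (w : M.W) (w' : M'.W) (ws : Fin n → M.W),
    R w w' → M.rel l w ws →
    ∃ ws' : Fin n → M'.W, (∀ k, R (ws k) (ws' k)) ∧ M'.rel (φ.ms l) w' ws'

/-- Refinement preserves positive existential sentences in
hybridised propositional logic (instance of the paper's Theorem 3). -/
theorem HPL_refinement_preserves_positive_existential {P Nom : Type}
    {Λ : ℕ → Type} {P' Nom' : Type} {Λ' : ℕ → Type}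
    (φ : HPLMor P Nom Λ P' Nom' Λ')
    (M : HPLModel P Nom Λ) (M' : HPLModel P' Nom' Λ')
    (R : M.W → M'.W → Prop) (hR : IsHPLRefinement φ M M' R) :
    ∀ (w : M.W) (w' : M'.W), R w w' → ∀ ρ : HPLPosSent P Nom Λ,
      HPLPosSat M w ρ → HPLPosSat M' w' (HPLPosTrans φ ρ) := by
  intro w w' h ρ hρ
  induction ρ generalizing w w' with
  | base ρ =>
    simp only [HPLPosTrans, HPLPosSat] at hρ ⊢
    exact hR.elem_pres w w' h ρ hρ
  | nom i =>
    simp only [HPLPosTrans, HPLPosSat] at hρ ⊢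
    exact hR.nom_imp w w' h i hρ
  | or ρ ρ' ih ih' =>
    simp only [HPLPosTrans, HPLPosSat] at hρ ⊢
    exact hρ.imp (ih w w' h) (ih' w w' h)
  | and ρ ρ' ih ih' =>
    simp only [HPLPosTrans, HPLPosSat] at hρ ⊢
    exact hρ.imp (ih w w' h) (ih' w w' h)
  | dia l ξ ih =>
    simp only [HPLPosTrans, HPLPosSat] at hρ ⊢
    obtain ⟨ws, hws, hξ⟩ := hρ
    obtain ⟨ws', hR', hws'⟩ := hR.forth l w w' ws h hws
    exact ⟨ws', hws', fun k => ih k _ _ (hR' k) (hξ k)⟩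
  | _ i ρ ih =>
    simp only [HPLPosTrans, HPLPosSat] at hρ ⊢
    exact ih _ _ (hR.nom_rel i) hρ
end

section
/- Surjective refinement preserves global satisfaction of positive existential sentences in hybridised propositional logic (instance of the paper's Corollary 4): let φ : (P,Nom,Λ) → (P',Nom',Λ') be an HPL signature morphism and R a φ-refinement relation between models (M,W) and (M',W') that is surjective (every world of W' is R-related to some world of W). Then for every positive existential HPL sentence ρ over (P,Nom,Λ), if (M,W) globally satisfies ρ then (M',W') globally satisfies Sen(φ)(ρ). -/
/-- A refinement relation preserves local satisfaction of positive existential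
sentences. -/
theorem IsHPLRefinement.hplPosSat_trans {P Nom : Type} {Λ : ℕ → Type}
    {P' Nom' : Type} {Λ' : ℕ → Type} {φ : HPLMor P Nom Λ P' Nom' Λ'}
    {M : HPLModel P Nom Λ} {M' : HPLModel P' Nom' Λ'}
    {R : M.W → M'.W → Prop} (hR : IsHPLRefinement φ M M' R)
    (ρ : HPLPosSent P Nom Λ) {w : M.W} {w' : M'.W} (hw : R w w')
    (h : HPLPosSat M w ρ) : HPLPosSat M' w' (HPLPosTrans φ ρ) := by
  match ρ, h with
  | .base ρ, h => exact hR.elem_pres w w' hw ρ h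
  | .nom i, h => exact hR.nom_imp w w' hw i h
  | .or ρ ρ', h => exact Or.imp (hR.hplPosSat_trans ρ hw) (hR.hplPosSat_trans ρ' hw) h
  | .and ρ ρ', h => exact And.imp (hR.hplPosSat_trans ρ hw) (hR.hplPosSat_trans ρ' hw) h
  | .at i ρ, h => exact hR.hplPosSat_trans ρ (hR.nom_rel i) h
  | .dia l ξ, ⟨ws, hl, hξ⟩ =>
    obtain ⟨ws', hws, hl'⟩ := hR.forth l w w' ws hw hl
    exact ⟨ws', hl', fun k => hR.hplPosSat_trans (ξ k) (hws k) (hξ k)⟩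

/-- Surjective refinement preserves global satisfaction of
positive existential sentences in hybridised propositional logic (instance of
the paper's Corollary 4). -/
theorem HPL_surjective_refinement_preserves_global {P Nom : Type}
    {Λ : ℕ → Type} {P' Nom' : Type} {Λ' : ℕ → Type}
    (φ : HPLMor P Nom Λ P' Nom' Λ')
    (M : HPLModel P Nom Λ) (M' : HPLModel P' Nom' Λ')
    (R : M.W → M'.W → Prop) (hR : IsHPLRefinement φ M M' R)
    (hsurj : ∀ w' : M'.W, ∃ w : M.W, R w w') :
    ∀ ρ : HPLPosSent P Nom Λ,
      HPLPosGSat M ρ → HPLPosGSat M' (HPLPosTrans φ ρ) := by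
  intro ρ hρ w'
  obtain ⟨w, hw⟩ := hsurj w'
  exact hR.hplPosSat_trans ρ hw (hρ w)
end
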